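/- Let G be a compact torus with an automorphism σ and T = (G^σ)₀ the identity component of the fixed subgroup. Then the quotient group G/(T·{g⁻¹σ(g) : g ∈ G}) (i.e., the cokernel of H¹(ℤ,T) → H¹(ℤ,G) combined with coboundaries) relates as follows: the set (G^σ)/T is finite, and the fixed-point set of the induced automorphism on G/T is finite if and only if σ is 1-semisimple. -/

import Mathlib

/-- A closed subgroup `H` of a compact group is covered by finitely many translates of any
subgroup containing a neighbourhood of `0` in `H`. -/
theorem exists_finset_subset_iUnion_translates {G : Type*} [AddCommGroup G] [TopologicalSpace G]
    [IsTopologicalAddGroup G] [CompactSpace G] {H P : AddSubgroup G} (hH : IsClosed (H : Set G))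
    {U : Set G} (hU : U ∈ nhds (0 : G)) (hHU : ∀ x ∈ H, x ∈ U → x ∈ P) :
    ∃ S : Finset G, (H : Set G) ⊆ ⋃ s ∈ S, (fun t => s + t) '' (P : Set G) := by
  obtain ⟨S, hSH, hS⟩ := hH.isCompact.elim_nhds_subcover (fun x => (fun y => -x + y) ⁻¹' U)
    fun x _ => (continuous_const_add (-x)).continuousAt.preimage_mem_nhds (by simpa using hU)
  refine ⟨S, fun y hy => ?_⟩
  obtain ⟨x, hx, hxy⟩ := Set.mem_iUnion₂.1 (hS hy)
  exact Set.mem_iUnion₂.2 ⟨x, hx, -x + y,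
    hHU _ (H.add_mem (H.neg_mem (hSH x hx)) hy) hxy, by simp⟩

open Pointwise in
/-- A connected subgroup containing a neighbourhood of `0` in `H` is the identity component
of `H`. -/
theorem connectedComponentIn_zero_eq_of_nhds {G : Type*} [AddCommGroup G] [TopologicalSpace G]
    [IsTopologicalAddGroup G] {H P : AddSubgroup G} (hPH : P ≤ H)
    (hP : IsPreconnected (P : Set G))
    {U : Set G} (hU : U ∈ nhds (0 : G)) (hHU : ∀ x ∈ H, x ∈ U → x ∈ P) :
    connectedComponentIn (H : Set G) 0 = P := by
  refine Set.Subset.antisymm (fun x hx => ?_) (hP.subset_connectedComponentIn P.zero_mem hPH)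
  obtain ⟨W, hWU, hWo, hW0⟩ := mem_nhds_iff.1 hU
  have hsub := connectedComponentIn_subset (H : Set G) 0
  by_contra hxP
  obtain ⟨y, hyT, ⟨p, hp, u, hu, hpu⟩, q, ⟨hqH, hqP⟩, w, hw, hqw⟩ :=
    isPreconnected_connectedComponentIn (F := (H : Set G)) (x := (0 : G))
      ((P : Set G) + W) (((H : Set G) \ P) + W) hWo.add_left hWo.add_left
      (fun z hz => by
        by_cases h : z ∈ P
        · exact Or.inl ⟨z, h, 0, hW0, add_zero z⟩
        · exact Or.inr ⟨z, ⟨hsub hz, h⟩, 0, hW0, add_zero z⟩)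
      ⟨0, mem_connectedComponentIn H.zero_mem, 0, P.zero_mem, 0, hW0, add_zero 0⟩
      ⟨x, hx, x, ⟨hsub hx, hxP⟩, 0, hW0, add_zero x⟩
  have hyH : y ∈ H := hsub hyT
  simp only at hpu hqw
  have huP : u ∈ P := hHU u (by
    rw [← add_sub_cancel_left p u, hpu]; exact H.sub_mem hyH (hPH hp)) (hWU hu)
  have hwP : w ∈ P := hHU w (by
    rw [← add_sub_cancel_left q w, hqw]; exact H.sub_mem hyH hqH) (hWU hw)
  have hyP : y ∈ P := hpu ▸ P.add_mem hp huP
  apply hqP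
  have : q = y - w := eq_sub_of_add_eq hqw
  rw [this]
  exact P.sub_mem hyP hwP

/-- If `N v` lies in a discrete subgroup and `v` is close to `0`, then `N v = 0`. -/
theorem eventually_eq_zero_of_map_mem {V : Type*} [NormedAddCommGroup V] [NormedSpace ℝ V]
    [FiniteDimensional ℝ V] (Λ : AddSubgroup V) [DiscreteTopology Λ] (N : V →ₗ[ℝ] V) :
    ∀ᶠ v in nhds (0 : V), N v ∈ Λ → N v = 0 := by
  obtain ⟨W, hW, hWΛ⟩ := (nhds_inter_eq_singleton_of_mem_discrete
    (s := (Λ : Set V)) (isDiscrete_iff_discreteTopology.2 inferInstance) Λ.zero_mem)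
  have hN : Filter.Tendsto N (nhds 0) (nhds 0) := by
    simpa using N.continuous_of_finiteDimensional.tendsto 0
  filter_upwards [hN hW] with v hv hvΛ
  have : N v ∈ W ∩ (Λ : Set V) := ⟨hv, hvΛ⟩
  rwa [hWΛ] at this

/-- If the line `ℝ v` is covered by countably many translates of a subspace, then that subspace
contains `v`. -/
theorem mem_of_forall_exists_smul_sub_mem {V ι : Type*} [AddCommGroup V] [Module ℝ V]
    [Countable ι] (K : Submodule ℝ V) (c : ι → V) (v : V)
    (h : ∀ t : ℝ, ∃ i, t • v - c i ∈ K) : v ∈ K := by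
  choose f hf using h
  obtain ⟨a, b, hab, hne⟩ := Function.not_injective_iff.1 fun hinj : f.Injective =>
    not_countable (α := ℝ) hinj.countable
  have h1 : (a - b) • v ∈ K := by
    have := K.sub_mem (hf a) (hf b)
    rw [hab] at this
    rw [sub_smul]
    simpa using this
  exact (K.smul_mem_iff (sub_ne_zero.2 hne)).1 h1


/-- Compact torus `G = V ⧸ Λ` with automorphism `σ` induced by `L` (so `dσ = L`),
`T = (G^σ)₀`.  Then `(G^σ)/T` is finite (the fixed subgroup is covered by finitely many
translates of `T`), and the fixed-point set of the induced automorphism on `G/T`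
(namely `{x | σ(x) - x ∈ T}` modulo `T`) is finite iff `σ` is `1`-semisimple, i.e.
`ker(1−dσ) = ker((1−dσ)²)`. -/
theorem stmt18 {V : Type*} [NormedAddCommGroup V] [NormedSpace ℝ V]
    [FiniteDimensional ℝ V]
    (Λ : AddSubgroup V) [DiscreteTopology Λ] [CompactSpace (V ⧸ Λ)]
    (L : V ≃ₗ[ℝ] V) (hΛ : ∀ x ∈ Λ, L x ∈ Λ)
    (σ : (V ⧸ Λ) →+ V ⧸ Λ)
    (hσ : σ = QuotientAddGroup.map Λ Λ L.toLinearMap.toAddMonoidHom hΛ)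
    (T : Set (V ⧸ Λ)) (hT : T = connectedComponentIn {x : V ⧸ Λ | σ x = x} 0) :
    (∃ S : Finset (V ⧸ Λ), {x : V ⧸ Λ | σ x = x} ⊆ ⋃ s ∈ S, (fun t => s + t) '' T) ∧
    ((∃ S : Finset (V ⧸ Λ), {x : V ⧸ Λ | σ x - x ∈ T} ⊆ ⋃ s ∈ S, (fun t => s + t) '' T) ↔
      LinearMap.ker (1 - (L : V →ₗ[ℝ] V)) =
        LinearMap.ker ((1 - (L : V →ₗ[ℝ] V)) ^ 2)) := by
  subst hσ
  set σ : (V ⧸ Λ) →+ V ⧸ Λ := QuotientAddGroup.map Λ Λ L.toLinearMap.toAddMonoidHom hΛ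
  have hσmk : ∀ v : V, σ (v : V ⧸ Λ) = (L v : V) := fun v => rfl
  have hσc : Continuous σ :=
    continuous_quot_lift _ (continuous_quot_mk.comp L.toLinearMap.continuous_of_finiteDimensional)
  have hΛc : IsClosed (Λ : Set V) := AddSubgroup.isClosed_of_discrete
  let N : V →ₗ[ℝ] V := 1 - (L : V →ₗ[ℝ] V)
  have hN : ∀ v, N v = v - L v := fun v => rfl
  let P : AddSubgroup (V ⧸ Λ) :=
    (LinearMap.ker N).toAddSubgroup.map (QuotientAddGroup.mk' Λ)
  let F : AddSubgroup (V ⧸ Λ) := (σ - AddMonoidHom.id _).ker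
  let B : AddSubgroup (V ⧸ Λ) := P.comap (σ - AddMonoidHom.id _)
  have hFset : {x : V ⧸ Λ | σ x = x} = F := by
    ext x; simp [F, AddMonoidHom.mem_ker, sub_eq_zero]
  have hFclosed : IsClosed (F : Set (V ⧸ Λ)) := hFset ▸ isClosed_eq hσc continuous_id
  have hPF : P ≤ F := by
    rintro _ ⟨v, hv, rfl⟩
    have hv' : v - L v = 0 := hv
    change σ (v : V ⧸ Λ) - (v : V ⧸ Λ) = 0
    rw [hσmk, ← sub_eq_zero.1 hv', sub_self]
  let U : Set (V ⧸ Λ) := (fun v : V => (v : V ⧸ Λ)) '' {v | N v ∈ Λ → N v = 0}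
  have hU : U ∈ nhds (0 : V ⧸ Λ) :=
    QuotientAddGroup.isOpenMap_coe.image_mem_nhds (eventually_eq_zero_of_map_mem Λ N)
  have hFmem : ∀ v : V, (v : V ⧸ Λ) ∈ F → N v ∈ Λ := by
    intro v hx
    have hx' : σ (v : V ⧸ Λ) - (v : V ⧸ Λ) = 0 := hx
    rw [hσmk, sub_eq_zero, eq_comm, QuotientAddGroup.eq] at hx'
    rw [hN, ← neg_mem_iff]
    convert hx' using 1
    abel
  have hFU : ∀ x ∈ F, x ∈ U → x ∈ P := by
    rintro _ hx ⟨v, hv, rfl⟩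
    refine ⟨v, hv ?_, rfl⟩
    exact hFmem v hx
  have hPconn : IsPreconnected (P : Set (V ⧸ Λ)) :=
    (LinearMap.ker N).convex.isPreconnected.image _ continuous_quot_mk.continuousOn
  have hTP : T = P := by
    rw [hT, hFset]
    exact connectedComponentIn_zero_eq_of_nhds hPF hPconn hU hFU
  have hPclosed : IsClosed (P : Set (V ⧸ Λ)) := by
    refine isClosed_of_closure_subset ?_
    conv_rhs => rw [← hTP, hT, hFset]
    exact hPconn.closure.subset_connectedComponentIn (subset_closure P.zero_mem)
      (closure_minimal hPF hFclosed)
  have hBset : {x : V ⧸ Λ | σ x - x ∈ T} = B := by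
    rw [hTP]; rfl
  have hBclosed : IsClosed (B : Set (V ⧸ Λ)) :=
    hPclosed.preimage (hσc.sub continuous_id)
  rw [hFset, hBset, hTP]
  refine ⟨exists_finset_subset_iUnion_translates hFclosed hU hFU, ?_, ?_⟩
  · rintro ⟨S, hS⟩
    refine le_antisymm (fun v hv => ?_) (fun v hv => ?_)
    · rw [LinearMap.mem_ker] at hv ⊢
      rw [pow_two, Module.End.mul_apply, hv, map_zero]
    · change N v = 0
      have hv' : N (N v) = 0 := by
        rw [LinearMap.mem_ker, pow_two, Module.End.mul_apply] at hv
        exact hv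
      have : Countable Λ := TopologicalSpace.separableSpace_iff_countable.1 inferInstance
      refine mem_of_forall_exists_smul_sub_mem (LinearMap.ker N)
        (fun i : S × Λ => (i.1 : V ⧸ Λ).out + i.2) v fun t => ?_
      have ht : ((t • v : V) : V ⧸ Λ) ∈ B := by
        refine ⟨-N (t • v), ?_, ?_⟩
        · change N (-N (t • v)) = 0
          simp [hv']
        · rw [hN, neg_sub]; rfl
      obtain ⟨s, hs, _, ⟨k, hk, rfl⟩, hsk⟩ := Set.mem_iUnion₂.1 (hS ht)
      have hsk' : ((s.out + k : V) : V ⧸ Λ) = ((t • v : V) : V ⧸ Λ) := by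
        rw [QuotientAddGroup.mk_add, QuotientAddGroup.out_eq']; exact hsk
      refine ⟨(⟨s, hs⟩, ⟨_, QuotientAddGroup.eq.1 hsk'⟩), ?_⟩
      have hkN : N k = 0 := hk
      rw [LinearMap.mem_ker, ← hkN]
      congr 1
      simp only
      abel
  · intro hker
    refine exists_finset_subset_iUnion_translates hBclosed
      (QuotientAddGroup.isOpenMap_coe.image_mem_nhds
        (eventually_eq_zero_of_map_mem Λ (N ^ 2))) ?_
    rintro _ hx ⟨v, hv, rfl⟩
    refine ⟨v, ?_, rfl⟩
    change v ∈ LinearMap.ker (1 - (L : V →ₗ[ℝ] V))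
    rw [hker]
    refine hv ?_
    have hx' : σ (v : V ⧸ Λ) - (v : V ⧸ Λ) ∈ F := hPF hx
    rw [hσmk, ← QuotientAddGroup.mk_sub, ← neg_sub, ← hN] at hx'
    have := hFmem _ hx'
    rw [map_neg, neg_mem_iff] at this
    rwa [pow_two, Module.End.mul_apply]
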